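/- arXiv:1204.5213 — 2 statements merged into one kernel-verified Lean document; each statement's English description precedes it below -/
import Mathlib

section
/- For every i ≥ 1 and all k, k' with 0 ≤ k, k' < 2^i and k ≠ k', the (k,i)-encoding coalition S_{k,i} is not a superset of any left-shift of the (k',i)-encoding coalition S_{k',i}; consequently, each S_{k,i} is a roof of the i-bit roof game G_{i-bit}. -/
/-- `S'` is a direct left-shift of `S`: some player `p ∈ S` with `p ≥ 2` and
`p − 1 ∉ S` is replaced by `p − 1`. -/
def DLS (S S' : Finset ℕ) : Prop :=
  ∃ p ∈ S, 2 ≤ p ∧ p - 1 ∉ S ∧ S' = insert (p - 1) (S.erase p)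

/-- `S'` is a left-shift of `S` (a possibly empty sequence of direct
left-shifts). -/
def LeftShift : Finset ℕ → Finset ℕ → Prop :=
  Relation.ReflTransGen DLS

/-- `S'` is a direct right-shift of `S` (on players `{1,…,n}`): some player
`p ∈ S` with `p + 1 ≤ n` and `p + 1 ∉ S` is replaced by `p + 1`. -/
def DRS (n : ℕ) (S S' : Finset ℕ) : Prop :=
  ∃ p ∈ S, p + 1 ≤ n ∧ p + 1 ∉ S ∧ S' = insert (p + 1) (S.erase p)

/-- `S'` is a right-shift of `S` (a possibly empty sequence of direct
right-shifts). -/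
def RightShift (n : ℕ) : Finset ℕ → Finset ℕ → Prop :=
  Relation.ReflTransGen (DRS n)

/-- The `(k,i)`-encoding coalition `S_{k,i}` on players `{1,…,4i}`. -/
def enc (i k : ℕ) : Finset ℕ :=
  (Finset.Icc 1 i).biUnion fun j =>
    if Nat.testBit k (j - 1) then {4 * (j - 1) + 1, 4 * (j - 1) + 4}
    else {4 * (j - 1) + 2, 4 * (j - 1) + 3}

/-- The `i`-bit roof game `G_{i-bit}` on `n = 4i` players: a coalition is winning
iff it is a superset of a left-shift of `S_{k,i}` for some `k < 2^i`. -/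
def GBit (i : ℕ) (C : Finset ℕ) : Prop :=
  ∃ k < 2 ^ i, ∃ T : Finset ℕ, LeftShift (enc i k) T ∧ T ⊆ C

/-- `S` is a minimal winning coalition of `v`. -/
def IsMWCn (v : Finset ℕ → Prop) (S : Finset ℕ) : Prop :=
  v S ∧ ∀ p ∈ S, ¬ v (S.erase p)

/-- `S` is a roof of the game `v` on players `{1,…,n}`: a minimal winning
coalition all of whose right-shifts other than itself are losing. -/
def IsRoofN (n : ℕ) (v : Finset ℕ → Prop) (S : Finset ℕ) : Prop :=
  IsMWCn v S ∧ ∀ S', RightShift n S S' → S' ≠ S → ¬ v S'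

/-- Number of elements of `S` strictly below `m`. -/
def cnt (S : Finset ℕ) : ℕ → ℕ
  | 0 => 0
  | m + 1 => cnt S m + if m ∈ S then 1 else 0

theorem cnt_mono {S T : Finset ℕ} (h : S ⊆ T) (m : ℕ) : cnt S m ≤ cnt T m := by
  induction m with
  | zero => simp [cnt]
  | succ m ih =>
    have := @h m
    simp only [cnt]
    split_ifs <;> first | omega | tauto

theorem cnt_swap_left {S : Finset ℕ} {q : ℕ} (h1 : q + 1 ∈ S) (h2 : q ∉ S) (m : ℕ) :
    cnt (insert q (S.erase (q + 1))) m = cnt S m + if m = q + 1 then 1 else 0 := by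
  induction m with
  | zero => simp [cnt]
  | succ m ih => simp only [cnt, ih, Finset.mem_insert, Finset.mem_erase]; grind

theorem cnt_swap_right {S : Finset ℕ} {q : ℕ} (h1 : q ∈ S) (h2 : q + 1 ∉ S) (m : ℕ) :
    cnt (insert (q + 1) (S.erase q)) m + (if m = q + 1 then 1 else 0) = cnt S m := by
  induction m with
  | zero => simp [cnt]
  | succ m ih => simp only [cnt, ← ih, Finset.mem_insert, Finset.mem_erase]; grind

theorem cnt_erase {S : Finset ℕ} {p : ℕ} (h1 : p ∈ S) (m : ℕ) :
    cnt (S.erase p) m + (if p < m then 1 else 0) = cnt S m := by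
  induction m with
  | zero => simp [cnt]
  | succ m ih => simp only [cnt, ← ih, Finset.mem_erase]; grind

theorem cnt_leftShift {S T : Finset ℕ} (h : LeftShift S T) (m : ℕ) : cnt S m ≤ cnt T m := by
  induction h with
  | refl => exact le_rfl
  | tail _ h ih =>
    obtain ⟨p, hp, h2, h3, rfl⟩ := h
    obtain ⟨q, rfl⟩ : ∃ q, p = q + 1 := ⟨p - 1, by omega⟩
    simp only [Nat.add_sub_cancel] at h3 ⊢
    rw [cnt_swap_left hp h3]
    omega

theorem cnt_rightShift {n : ℕ} {S T : Finset ℕ} (h : RightShift n S T) (m : ℕ) :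
    cnt T m ≤ cnt S m := by
  induction h with
  | refl => exact le_rfl
  | tail _ h ih =>
    obtain ⟨p, hp, h2, h3, rfl⟩ := h
    have := cnt_swap_right hp h3 m
    omega

theorem cnt_ext {S T : Finset ℕ} (h : ∀ m, cnt S m = cnt T m) : S = T := by
  ext x
  have h1 := h (x + 1)
  have h0 := h x
  simp only [cnt] at h1
  split_ifs at h1 <;> first | tauto | omega

theorem mem_enc (i k x : ℕ) : x ∈ enc i k ↔ ∃ j < i,
    (k.testBit j = true ∧ (x = 4 * j + 1 ∨ x = 4 * j + 4)) ∨
    (k.testBit j = false ∧ (x = 4 * j + 2 ∨ x = 4 * j + 3)) := by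
  simp only [enc, Finset.mem_biUnion, Finset.mem_Icc]
  constructor
  · rintro ⟨j, hj, hx⟩
    refine ⟨j - 1, by omega, ?_⟩
    split_ifs at hx with hb <;> simp_all
  · rintro ⟨j, hj, hx⟩
    refine ⟨j + 1, by omega, ?_⟩
    rcases hx with ⟨hb, hx⟩ | ⟨hb, hx⟩ <;> simp [hb, hx]

theorem mem_enc_block {i j : ℕ} (k : ℕ) (hj : j < i) :
    (4 * j + 1 ∈ enc i k ↔ k.testBit j = true) ∧ (4 * j + 2 ∈ enc i k ↔ k.testBit j = false) ∧
    (4 * j + 3 ∈ enc i k ↔ k.testBit j = false) ∧ (4 * j + 4 ∈ enc i k ↔ k.testBit j = true) := by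
  simp only [mem_enc]
  refine ⟨⟨?_, fun h => ⟨j, hj, by simp [h]⟩⟩, ⟨?_, fun h => ⟨j, hj, by simp [h]⟩⟩,
    ⟨?_, fun h => ⟨j, hj, by simp [h]⟩⟩, ⟨?_, fun h => ⟨j, hj, by simp [h]⟩⟩⟩ <;>
  · rintro ⟨l, hl, ⟨hb, hx⟩ | ⟨hb, hx⟩⟩ <;>
    first
    | omega
    | (obtain rfl : j = l := by omega
       exact hb)

theorem cnt_enc (i k j : ℕ) (hj : j ≤ i) : cnt (enc i k) (4 * j + 1) = 2 * j := by
  induction j with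
  | zero => simp [cnt, mem_enc]
  | succ j ih =>
    obtain ⟨h1, h2, h3, h4⟩ := mem_enc_block (i := i) (j := j) k (by omega)
    have := ih (by omega)
    rw [show 4 * (j + 1) + 1 = 4 * j + 1 + 1 + 1 + 1 + 1 by ring]
    rw [cnt, cnt, cnt, cnt, this]
    simp only [h1, h2, h3, h4, add_assoc, Nat.reduceAdd]
    cases k.testBit j <;> simp <;> ring

theorem enc_inj {i k k' : ℕ} (hk : k < 2 ^ i) (hk' : k' < 2 ^ i)
    (h : ∀ m, cnt (enc i k') m ≤ cnt (enc i k) m) : k = k' := by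
  apply Nat.eq_of_testBit_eq
  intro j
  by_cases hj : j < i
  · obtain ⟨h1, h2, h3, h4⟩ := mem_enc_block k hj
    obtain ⟨h1', h2', h3', h4'⟩ := mem_enc_block k' hj
    have e := cnt_enc i k j hj.le
    have e' := cnt_enc i k' j hj.le
    have a := h (4 * j + 1 + 1)
    have b := h (4 * j + 1 + 1 + 1 + 1)
    simp only [cnt] at a b e e'
    simp only [e, e', h1, h2, h3, h1', h2', h3', add_assoc, Nat.reduceAdd] at a b
    cases hb : k.testBit j <;> cases hb' : k'.testBit j <;> simp_all
  · have : 2 ^ i ≤ 2 ^ j := Nat.pow_le_pow_right (by norm_num) (by omega)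
    rw [Nat.testBit_lt_two_pow (by omega), Nat.testBit_lt_two_pow (by omega)]

/-- For `i ≥ 1` and distinct `k, k' < 2^i`, the coalition
`S_{k,i}` is not a superset of any left-shift of `S_{k',i}`; consequently, each
`S_{k,i}` is a roof of `G_{i-bit}`. -/
theorem stmt11 (i : ℕ) (hi : 1 ≤ i) (k k' : ℕ) (hk : k < 2 ^ i) (hk' : k' < 2 ^ i)
    (hne : k ≠ k') :
    (¬ ∃ T : Finset ℕ, LeftShift (enc i k') T ∧ T ⊆ enc i k) ∧
    IsRoofN (4 * i) (GBit i) (enc i k) := by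
  refine ⟨?_, ⟨⟨k, hk, _, Relation.ReflTransGen.refl, subset_rfl⟩, ?_⟩, ?_⟩
  · rintro ⟨T, hT, hs⟩
    exact hne (enc_inj hk hk' fun m => (cnt_leftShift hT m).trans (cnt_mono hs m))
  · rintro p hp ⟨l, hl, T, hT, hs⟩
    have h1 := (cnt_leftShift hT (4 * i + 1)).trans (cnt_mono hs _)
    have h2 := cnt_erase hp (4 * i + 1)
    rw [cnt_enc i k i le_rfl] at h2
    rw [cnt_enc i l i le_rfl] at h1
    have h3 : p < 4 * i + 1 := by
      obtain ⟨j, hj, h | h⟩ := (mem_enc i k p).1 hp <;> omega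
    simp only [h3, if_true] at h2
    omega
  · rintro S' hS hne' ⟨l, hl, T, hT, hs⟩
    have h1 := fun m => (cnt_leftShift hT m).trans (cnt_mono hs m)
    have h2 := cnt_rightShift hS
    obtain rfl := enc_inj hk hl fun m => (h1 m).trans (h2 m)
    exact hne' (cnt_ext fun m => le_antisymm (h2 m) (h1 m))
end

section
/- Let G and G' be canonical linear games on n players with sets of minimal winning coalitions W_min and W'_min respectively, such that W_min ⊆ W'_min and |W'_min| = |W_min| + 1. Let L_max be the set of maximal losing coalitions of G. Then there exist a coalition C ∈ L_max and an integer i with 0 ≤ i ≤ |C| such that W'_min = W_min ∪ {rtrunc(C, i)}. -/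
/-- Player `i` is at least as desirable as player `j` in the simple game `v`. -/
def Desir {n : ℕ} (v : Finset (Fin n) → Prop) (i j : Fin n) : Prop :=
  ∀ S : Finset (Fin n), i ∉ S → j ∉ S → v (insert j S) → v (insert i S)

/-- A canonical linear game: monotonic, and each smaller-numbered player is at
least as desirable as each larger-numbered one. -/
def IsCanLinGame (n : ℕ) (v : Finset (Fin n) → Prop) : Prop :=
  (∀ S T : Finset (Fin n), S ⊆ T → v S → v T) ∧
  ∀ i j : Fin n, i ≤ j → Desir v i j

/-- `S` is a minimal winning coalition of `v`. -/
def IsMWCv (n : ℕ) (v : Finset (Fin n) → Prop) (S : Finset (Fin n)) : Prop :=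
  v S ∧ ∀ p ∈ S, ¬ v (S.erase p)

/-- `S` is a maximal losing coalition of `v`. -/
def IsMaxLosingv (n : ℕ) (v : Finset (Fin n) → Prop) (S : Finset (Fin n)) : Prop :=
  ¬ v S ∧ ∀ p : Fin n, p ∉ S → v (insert p S)

/-- The `i`-th right-truncation of `S`: remove the `i` highest-numbered players
of `S`, i.e. keep the players having at least `i` larger players in `S`. -/
def rtrunc {n : ℕ} (S : Finset (Fin n)) (i : ℕ) : Finset (Fin n) :=
  S.filter fun p => i ≤ (S.filter fun q => p < q).card

theorem exists_mwc {n : ℕ} (v : Finset (Fin n) → Prop)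
    (T : Finset (Fin n)) (h : v T) : ∃ S, S ⊆ T ∧ IsMWCv n v S := by
  obtain ⟨S, hS, hm⟩ := (Set.toFinite {S | v S}).exists_le_minimal h
  refine ⟨S, hS, hm.prop, fun p hp hv => ?_⟩
  have := hm.le_of_le hv (Finset.erase_subset p S) hp
  simp at this

theorem rtrunc_eq {n : ℕ} (X C : Finset (Fin n)) (hXC : X ⊆ C)
    (h : ∀ c ∈ C, c ∉ X → ∀ x ∈ X, x < c) : rtrunc C (C \ X).card = X := by
  ext p
  simp only [rtrunc, Finset.mem_filter]
  constructor
  · rintro ⟨hp, hc⟩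
    by_contra hpX
    have : (C.filter fun q => p < q) ⊂ C \ X := by
      rw [Finset.ssubset_iff_of_subset]
      · exact ⟨p, by simp [hp, hpX], by simp⟩
      · intro q hq
        simp only [Finset.mem_filter, Finset.mem_sdiff] at hq ⊢
        exact ⟨hq.1, fun hqX => lt_asymm hq.2 (h p hp hpX q hqX)⟩
    exact absurd (Finset.card_lt_card this) (by omega)
  · intro hp
    refine ⟨hXC hp, Finset.card_le_card ?_⟩
    intro q hq
    simp only [Finset.mem_filter, Finset.mem_sdiff] at hq ⊢
    exact ⟨hq.1, h q hq.1 hq.2 p hp⟩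

theorem stmt17 (n : ℕ) (v v' : Finset (Fin n) → Prop)
    (hv : IsCanLinGame n v) (hv' : IsCanLinGame n v')
    (hsub : {S | IsMWCv n v S} ⊆ {S | IsMWCv n v' S})
    (hcard : {S | IsMWCv n v' S}.ncard = {S | IsMWCv n v S}.ncard + 1) :
    ∃ C : Finset (Fin n), IsMaxLosingv n v C ∧ ∃ i : ℕ, i ≤ C.card ∧
      {S | IsMWCv n v' S} = {S | IsMWCv n v S} ∪ {rtrunc C i} := by
  have hd : ({S | IsMWCv n v' S} \ {S | IsMWCv n v S}).ncard = 1 := by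
    rw [Set.ncard_sdiff hsub (Set.toFinite _)]; omega
  obtain ⟨X, hX⟩ := Set.ncard_eq_one.mp hd
  have heq : {S | IsMWCv n v' S} = {S | IsMWCv n v S} ∪ {X} := by
    rw [← hX, Set.union_sdiff_cancel hsub]
  have hXm : IsMWCv n v' X ∧ ¬ IsMWCv n v X := by
    have : X ∈ ({S | IsMWCv n v' S} \ {S | IsMWCv n v S}) := by rw [hX]; rfl
    exact this
  have hXl : ¬ v X := by
    intro hvX
    obtain ⟨Y, hYX, hY⟩ := exists_mwc v X hvX
    have hY' : IsMWCv n v' Y := hsub hY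
    by_cases hXY : X ⊆ Y
    · exact hXm.2 (hYX.antisymm hXY ▸ hY)
    · obtain ⟨p, hp, hpY⟩ := Finset.not_subset.mp hXY
      exact hXm.1.2 p hp (hv'.1 _ _ (Finset.subset_erase.mpr ⟨hYX, hpY⟩) hY'.1)
  obtain ⟨C, hXC, hm⟩ := (Set.toFinite {C : Finset (Fin n) | ¬ v C ∧
    ∀ c ∈ C, c ∉ X → ∀ x ∈ X, x < c}).exists_le_maximal
      (a := X) ⟨hXl, fun c hc hn => absurd hc hn⟩
  refine ⟨C, ⟨hm.prop.1, fun p hp => ?_⟩, (C \ X).card,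
    Finset.card_le_card Finset.sdiff_subset, ?_⟩
  · by_cases hlt : ∀ x ∈ X, x < p
    · by_contra hw
      refine hp (hm.le_of_ge (y := insert p C) ⟨hw, ?_⟩ (Finset.subset_insert p C)
        (Finset.mem_insert_self p C))
      intro c hc hcX
      rcases Finset.mem_insert.mp hc with rfl | hc
      · exact hlt
      · exact hm.prop.2 c hc hcX
    · push Not at hlt
      obtain ⟨x, hx, hpx⟩ := hlt
      have hpX : p ∉ X := fun h => hp (hXC h)
      have hw : v' (insert p (X.erase x)) := by
        apply hv'.2 p x hpx _ (by simp [hpX]) (by simp)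
        rw [Finset.insert_erase hx]
        exact hXm.1.1
      obtain ⟨Y, hY, hYm⟩ := exists_mwc v' _ hw
      have hYin : Y ∈ {S | IsMWCv n v S} ∪ {X} := heq ▸ hYm
      rcases hYin with hYv | hYX
      · refine hv.1 _ _ (hY.trans ?_) hYv.1
        exact Finset.insert_subset_insert p ((Finset.erase_subset x X).trans hXC)
      · have hYX : Y = X := hYX
        subst hYX
        have := hY hx
        simp only [Finset.mem_insert, Finset.mem_erase] at this
        rcases this with rfl | h
        · exact absurd hx hpX
        · exact absurd rfl h.1
  · rw [rtrunc_eq X C hXC hm.prop.2, heq]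
end
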